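/- There exists a constant C > 1 such that the following holds. Let q ∈ (0,1), let γ ∈ (0,1), and let q₁, q₂, q₃ > 0 satisfy q₁+q₂+q₃ = q and (1−γ)·q/3 < q_k < (1+γ)·q/3 for each k ∈ {1,2,3}. Then Q is irreducible, and its unique stationary distribution π satisfies ‖π − π_bal‖_∞ ≤ 3Cγq, i.e., |π(V) − π_bal(V)| ≤ 3Cγq for every state V ∈ 𝒱. -/

import Mathlib

/-- Edge type of a state: backward (`b`) or forward (`f`). -/
inductive Edge : Type
  | b | f
deriving DecidableEq

instance : Fintype Edge where
  elems := {Edge.b, Edge.f}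
  complete := fun x => by cases x <;> simp

/-- The 18-element state space `𝒱`: states `A_e^(k)` are encoded as
`Sum.inl (e, k)` and states `B_e^(kℓ)` (with `k ≠ ℓ`) as `Sum.inr (e, ⟨(k, ℓ), _⟩)`. -/
abbrev St : Type := (Edge × Fin 3) ⊕ (Edge × {kl : Fin 3 × Fin 3 // kl.1 ≠ kl.2})

/-- The element of `{0,1,2}` different from both `k` and `l` (when `k ≠ l`). -/
def third (k l : Fin 3) : Fin 3 :=
  ⟨(6 - (k : ℕ) - (l : ℕ)) % 3, Nat.mod_lt _ (by norm_num)⟩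

/-- The transition matrix `Q` with parameters `q₁ = qv 0`, `q₂ = qv 1`, `q₃ = qv 2`
(and `q = qv 0 + qv 1 + qv 2`); all entries not prescribed by the rules are `0`. -/
noncomputable def Qmat (qv : Fin 3 → ℝ) : Matrix St St ℝ :=
  Matrix.of fun s t =>
    match s, t with
    | Sum.inl (_, k), Sum.inl (Edge.b, j) => if j = k then 0 else qv (third k j)
    | Sum.inl (_, _), Sum.inl (Edge.f, _) => 0
    | Sum.inl (_, k), Sum.inr (Edge.f, kl) =>
        if kl.1.1 = k then (1 - (qv 0 + qv 1 + qv 2)) / 2 else 0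
    | Sum.inl (_, k), Sum.inr (Edge.b, kl) => if kl.1.1 = k then qv k / 2 else 0
    | Sum.inr (_, kl), Sum.inl (Edge.b, j) =>
        if j = kl.1.1 then qv (third kl.1.1 kl.1.2) else 0
    | Sum.inr (_, kl), Sum.inl (Edge.f, j) =>
        if j = third kl.1.1 kl.1.2 then 1 - (qv 0 + qv 1 + qv 2) else 0
    | Sum.inr (_, kl), Sum.inr (Edge.b, kl') =>
        if kl'.1.1 = kl.1.1 ∧ kl'.1.2 = third kl.1.1 kl.1.2 then qv kl.1.1
        else if kl'.1.1 = kl.1.2 ∧ kl'.1.2 = third kl.1.1 kl.1.2 then qv kl.1.2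
        else 0
    | Sum.inr _, Sum.inr (Edge.f, _) => 0

/-- The balanced transition matrix `Q_bal`, i.e. `Q` with `q₁ = q₂ = q₃ = q/3`. -/
noncomputable def Qbal (q : ℝ) : Matrix St St ℝ := Qmat fun _ => q / 3

/-- The distribution `π_bal` on `𝒱`. -/
noncomputable def piBal (q : ℝ) : St → ℝ
  | Sum.inl (Edge.b, _) => q / 6
  | Sum.inl (Edge.f, _) => (1 - q) / 6
  | Sum.inr (Edge.b, _) => q / 12
  | Sum.inr (Edge.f, _) => (1 - q) / 12

namespace Matrix

open Finset

section Invariant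

variable {n : Type*} [Fintype n] [DecidableEq n] {P : Matrix n n ℝ}

theorem abs_vecMul_eq_of_mem_rowStochastic (hP : P ∈ rowStochastic ℝ n) {v : n → ℝ}
    (hv : v ᵥ* P = v) : |v| ᵥ* P = |v| := by
  have hle : ∀ j ∈ univ, |v| j ≤ (|v| ᵥ* P) j := by
    intro j _
    calc |v| j = |(v ᵥ* P) j| := by rw [hv, Pi.abs_apply]
      _ ≤ ∑ i, |v i * P i j| := abs_sum_le_sum_abs _ _
      _ = (|v| ᵥ* P) j := by
        simp [vecMul, dotProduct, abs_mul, abs_of_nonneg (nonneg_of_mem_rowStochastic hP)]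
  have hsum : ∑ j, |v| j = ∑ j, (|v| ᵥ* P) j := by
    simp only [vecMul, dotProduct]
    rw [sum_comm]
    simp only [← mul_sum, sum_row_of_mem_rowStochastic hP, mul_one]
  funext j
  exact (((sum_eq_sum_iff_of_le hle).1 hsum) j (mem_univ j)).symm

theorem vecMul_pow_eq_of_vecMul_eq {v : n → ℝ} (hv : v ᵥ* P = v) (t : ℕ) :
    v ᵥ* P ^ t = v := by
  induction t with
  | zero => simp
  | succ t ih => rw [pow_succ, ← vecMul_vecMul, ih, hv]

theorem pos_of_vecMul_eq (hP : P ∈ rowStochastic ℝ n)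
    (hirr : ∀ i j, ∃ t : ℕ, 1 ≤ t ∧ 0 < (P ^ t) i j) {v : n → ℝ} (hv : v ᵥ* P = v)
    (h0 : 0 ≤ v) {i : n} (hi : v i ≠ 0) (j : n) : 0 < v j := by
  obtain ⟨t, -, ht⟩ := hirr i j
  have hPt := pow_mem hP t
  calc 0 < v i * (P ^ t) i j := mul_pos (lt_of_le_of_ne (h0 i) hi.symm) ht
    _ ≤ ∑ k, v k * (P ^ t) k j :=
      single_le_sum (f := fun k => v k * (P ^ t) k j)
        (fun k _ => mul_nonneg (h0 k) (nonneg_of_mem_rowStochastic hPt)) (mem_univ i)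
    _ = v j := congrFun (vecMul_pow_eq_of_vecMul_eq hv t) j

theorem eq_zero_of_vecMul_eq_of_sum_eq_zero (hP : P ∈ rowStochastic ℝ n)
    (hirr : ∀ i j, ∃ t : ℕ, 1 ≤ t ∧ 0 < (P ^ t) i j) {v : n → ℝ} (hv : v ᵥ* P = v)
    (hsum : ∑ i, v i = 0) : v = 0 := by
  have habs := abs_vecMul_eq_of_mem_rowStochastic hP hv
  have hsub : (|v| - v) ᵥ* P = |v| - v := by rw [sub_vecMul, habs, hv]
  have hadd : (|v| + v) ᵥ* P = |v| + v := by rw [add_vecMul, habs, hv]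
  have hsub0 : 0 ≤ |v| - v := fun i => by simpa using le_abs_self (v i)
  have hadd0 : 0 ≤ |v| + v := fun i => by
    have := neg_abs_le (v i)
    simp only [Pi.zero_apply, Pi.add_apply, Pi.abs_apply]
    linarith
  suffices h : ∑ i, |v i| = 0 by
    funext i
    simpa using (sum_eq_zero_iff_of_nonneg fun i _ => abs_nonneg (v i)).1 h i (mem_univ i)
  by_cases hs : ∀ i, (|v| - v) i = 0
  · rw [← hsum]
    exact sum_congr rfl fun i _ => by simpa [sub_eq_zero] using hs i
  by_cases ha : ∀ i, (|v| + v) i = 0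
  · rw [← neg_zero, ← hsum, ← sum_neg_distrib]
    exact sum_congr rfl fun i _ => eq_neg_of_add_eq_zero_left (by simpa using ha i)
  push Not at hs ha
  obtain ⟨i, hi⟩ := hs
  obtain ⟨j, hj⟩ := ha
  have h1 := mul_pos (pos_of_vecMul_eq hP hirr hsub hsub0 hi i)
    (pos_of_vecMul_eq hP hirr hadd hadd0 hj i)
  simp only [Pi.sub_apply, Pi.add_apply, Pi.abs_apply] at h1
  nlinarith [sq_abs (v i)]

theorem existsUnique_stationary [Nonempty n] (hP : P ∈ rowStochastic ℝ n)
    (hirr : ∀ i j, ∃ t : ℕ, 1 ≤ t ∧ 0 < (P ^ t) i j) :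
    ∃! p : n → ℝ, (∀ i, 0 ≤ p i) ∧ ∑ i, p i = 1 ∧ ∀ j, ∑ i, p i * P i j = p j := by
  have hdet : (1 - P).det = 0 :=
    exists_mulVec_eq_zero_iff.1 ⟨1, one_ne_zero, by
      rw [sub_mulVec, one_mulVec, one_vecMul_of_mem_rowStochastic hP, sub_self]⟩
  obtain ⟨v, hv0, hv⟩ := exists_vecMul_eq_zero_iff.2 hdet
  rw [vecMul_sub, vecMul_one, sub_eq_zero] at hv
  have habs := abs_vecMul_eq_of_mem_rowStochastic hP hv.symm
  obtain ⟨i, hi⟩ := Function.ne_iff.1 hv0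
  have hpos : 0 < ∑ i, |v i| :=
    sum_pos' (fun j _ => abs_nonneg _) ⟨i, mem_univ i, abs_pos.2 hi⟩
  refine ⟨fun j => |v j| / ∑ i, |v i|,
    ⟨fun j => by positivity, by rw [← sum_div, div_self hpos.ne'], fun j => ?_⟩, ?_⟩
  · simp only [div_mul_eq_mul_div, ← sum_div]
    congr 1
    exact congrFun habs j
  rintro p ⟨-, hp1, hp⟩
  rw [← sub_eq_zero]
  refine eq_zero_of_vecMul_eq_of_sum_eq_zero hP hirr ?_ ?_
  · rw [sub_vecMul]
    congr 1
    · exact funext hp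
    funext j
    simp only [vecMul, dotProduct, div_mul_eq_mul_div, ← sum_div]
    congr 1
    exact congrFun habs j
  · simp only [Pi.sub_apply, sum_sub_distrib, hp1, ← sum_div, div_self hpos.ne', sub_self]

theorem exists_pow_pos_of_transGen (hP : ∀ i j, 0 ≤ P i j) {i j : n}
    (h : Relation.TransGen (fun i j => 0 < P i j) i j) : ∃ t : ℕ, 1 ≤ t ∧ 0 < (P ^ t) i j := by
  induction h with
  | single h => exact ⟨1, le_rfl, by simpa using h⟩
  | @tail k l _ h ih =>
    obtain ⟨t, -, ht⟩ := ih
    refine ⟨t + 1, by omega, ?_⟩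
    rw [pow_succ, mul_apply]
    exact (mul_pos ht h).trans_le
      (single_le_sum (f := fun m => (P ^ t) i m * P m l)
        (fun m _ => mul_nonneg (pow_apply_nonneg hP t i m) (hP m l)) (mem_univ k))

end Invariant

end Matrix

open Finset

theorem third_eq {k l m : Fin 3} (hkl : k ≠ l) (hkm : k ≠ m) (hlm : l ≠ m) : third k l = m := by
  revert k l m; decide

theorem sum_St {k l m : Fin 3} (hkl : k ≠ l) (hkm : k ≠ m) (hlm : l ≠ m) (f : St → ℝ) :
    ∑ V, f V =
      (f (.inl (.b, k)) + f (.inl (.f, k))) + (f (.inl (.b, l)) + f (.inl (.f, l))) +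
      (f (.inl (.b, m)) + f (.inl (.f, m))) +
      (f (.inr (.b, ⟨(k, l), hkl⟩)) + f (.inr (.f, ⟨(k, l), hkl⟩))) +
      (f (.inr (.b, ⟨(k, m), hkm⟩)) + f (.inr (.f, ⟨(k, m), hkm⟩))) +
      (f (.inr (.b, ⟨(l, k), hkl.symm⟩)) + f (.inr (.f, ⟨(l, k), hkl.symm⟩))) +
      (f (.inr (.b, ⟨(l, m), hlm⟩)) + f (.inr (.f, ⟨(l, m), hlm⟩))) +
      (f (.inr (.b, ⟨(m, k), hkm.symm⟩)) + f (.inr (.f, ⟨(m, k), hkm.symm⟩))) +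
      (f (.inr (.b, ⟨(m, l), hlm.symm⟩)) + f (.inr (.f, ⟨(m, l), hlm.symm⟩))) := by
  have hFin : (univ : Finset (Fin 3)) = {k, l, m} := by revert k l m; decide
  have hEdge : (univ : Finset Edge) = {.b, .f} := rfl
  have hPair : (univ : Finset {kl : Fin 3 × Fin 3 // kl.1 ≠ kl.2}) =
      {⟨(k, l), hkl⟩, ⟨(k, m), hkm⟩, ⟨(l, k), hkl.symm⟩, ⟨(l, m), hlm⟩, ⟨(m, k), hkm.symm⟩,
        ⟨(m, l), hlm.symm⟩} := by revert k l m; decide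
  simp only [Fintype.sum_sum_type, Fintype.sum_prod_type, hFin, hEdge, hPair]
  simp [hkl, hkm, hlm, hkl.symm, hkm.symm, hlm.symm]
  ring

/-- The `e`-marginal of a vector on `𝒱` at the states `A^(k)`. -/
def margA (p : St → ℝ) (k : Fin 3) : ℝ := p (.inl (.b, k)) + p (.inl (.f, k))

/-- The `e`-marginal of a vector on `𝒱` at the states `B^(kℓ)`. -/
def margB (p : St → ℝ) {k l : Fin 3} (h : k ≠ l) : ℝ :=
  p (.inr (.b, ⟨(k, l), h⟩)) + p (.inr (.f, ⟨(k, l), h⟩))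

section Entries

variable {k l m : Fin 3} (hkl : k ≠ l) (hkm : k ≠ m) (hlm : l ≠ m) (p : St → ℝ) (qv : Fin 3 → ℝ)
include hkl hkm hlm

theorem sum_mul_Qmat_A_b : ∑ V, p V * Qmat qv V (.inl (.b, k)) =
    (margA p l + margB p hkl) * qv m + (margA p m + margB p hkm) * qv l := by
  rw [sum_St hkl hkm hlm]
  simp [Qmat, margA, margB, third_eq hkl hkm hlm, third_eq hkm hkl hlm.symm,
    third_eq hkl.symm hlm hkm, third_eq hkm.symm hlm.symm hkl, hkl, hkm]
  ring

theorem sum_mul_Qmat_A_f : ∑ V, p V * Qmat qv V (.inl (.f, k)) =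
    (margB p hlm + margB p hlm.symm) * (1 - (qv 0 + qv 1 + qv 2)) := by
  rw [sum_St hkl hkm hlm]
  simp [Qmat, margB, third_eq hkl hkm hlm, third_eq hkm hkl hlm.symm,
    third_eq hkl.symm hlm hkm, third_eq hkm.symm hlm.symm hkl, third_eq hlm hkl.symm hkm.symm,
    third_eq hlm.symm hkm.symm hkl.symm, hkl, hkm]
  ring

theorem sum_mul_Qmat_B_b : ∑ V, p V * Qmat qv V (.inr (.b, ⟨(k, l), hkl⟩)) =
    (margA p k / 2 + (margB p hkm + margB p hkm.symm)) * qv k := by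
  rw [sum_St hkl hkm hlm]
  simp [Qmat, margA, margB, third_eq hkl hkm hlm, third_eq hkm hkl hlm.symm,
    third_eq hkl.symm hlm hkm, third_eq hkm.symm hlm.symm hkl, third_eq hlm hkl.symm hkm.symm,
    third_eq hlm.symm hkm.symm hkl.symm, hkl, hkm, hlm]
  ring

theorem sum_mul_Qmat_B_f : ∑ V, p V * Qmat qv V (.inr (.f, ⟨(k, l), hkl⟩)) =
    margA p k * (1 - (qv 0 + qv 1 + qv 2)) / 2 := by
  rw [sum_St hkl hkm hlm]
  simp [Qmat, margA, hkl, hkm]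
  ring

theorem sum_Qmat_A (e : Edge) : ∑ V, Qmat qv (.inl (e, k)) V =
    qv k + qv l + qv m + (1 - (qv 0 + qv 1 + qv 2)) := by
  rw [sum_St hkl hkm hlm]
  simp [Qmat, third_eq hkl hkm hlm, third_eq hkm hkl hlm.symm, hkl.symm, hkm.symm]
  ring

theorem sum_Qmat_B (e : Edge) : ∑ V, Qmat qv (.inr (e, ⟨(k, l), hkl⟩)) V =
    qv k + qv l + qv m + (1 - (qv 0 + qv 1 + qv 2)) := by
  rw [sum_St hkl hkm hlm]
  simp [Qmat, third_eq hkl hkm hlm, hkl, hkl.symm, hkm, hkm.symm, hlm, hlm.symm]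
  ring

theorem sum_perm : qv k + qv l + qv m = qv 0 + qv 1 + qv 2 := by
  have hFin : (univ : Finset (Fin 3)) = {k, l, m} := by revert k l m; decide
  rw [← Fin.sum_univ_three, hFin, sum_insert (by simp [hkl, hkm]), sum_pair hlm, add_assoc]

end Entries

theorem exists_third {k l : Fin 3} (h : k ≠ l) : ∃ m, k ≠ m ∧ l ≠ m := by
  revert k l; decide

section Chain

variable {qv : Fin 3 → ℝ}

theorem Qmat_mem_rowStochastic (h0 : ∀ k, 0 ≤ qv k) (h1 : qv 0 + qv 1 + qv 2 ≤ 1) :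
    Qmat qv ∈ Matrix.rowStochastic ℝ St := by
  rw [Matrix.mem_rowStochastic_iff_sum]
  constructor
  · rintro (⟨e, k⟩ | ⟨e, kl⟩) (⟨e' | e', k'⟩ | ⟨e' | e', kl'⟩) <;>
      simp only [Qmat, Matrix.of_apply] <;> (try split_ifs) <;>
      first | exact le_rfl | exact h0 _ | linarith | exact div_nonneg (h0 _) two_pos.le
  · rintro (⟨e, k⟩ | ⟨e, ⟨k, l⟩, hkl⟩)
    · obtain ⟨l, hkl⟩ := exists_ne k
      obtain ⟨m, hkm, hlm⟩ := exists_third hkl.symm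
      rw [sum_Qmat_A hkl.symm hkm hlm, sum_perm hkl.symm hkm hlm]
      ring
    · obtain ⟨m, hkm, hlm⟩ := exists_third hkl
      rw [sum_Qmat_B hkl hkm hlm, sum_perm hkl hkm hlm]
      ring

variable (h0 : ∀ k, 0 < qv k) (h1 : qv 0 + qv 1 + qv 2 < 1)
include h0

theorem Qmat_A_A_pos (e : Edge) {k l : Fin 3} (h : l ≠ k) :
    0 < Qmat qv (.inl (e, k)) (.inl (.b, l)) := by
  simp [Qmat, h, h0]

theorem transGen_A_b (k l : Fin 3) :
    Relation.TransGen (fun V V' => 0 < Qmat qv V V') (.inl (.b, k)) (.inl (.b, l)) := by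
  by_cases h : l = k
  · subst h
    obtain ⟨m, hm⟩ := exists_ne l
    exact .tail (.single (Qmat_A_A_pos h0 .b hm)) (Qmat_A_A_pos h0 .b hm.symm)
  · exact .single (Qmat_A_A_pos h0 .b h)

theorem exists_Qmat_A_b_pos (V : St) : ∃ k, 0 < Qmat qv V (.inl (.b, k)) := by
  obtain ⟨e, k⟩ | ⟨e, ⟨k, l⟩, hkl⟩ := V
  · obtain ⟨l, hl⟩ := exists_ne k
    exact ⟨l, Qmat_A_A_pos h0 e hl⟩
  · exact ⟨k, by simp [Qmat, h0]⟩

include h1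

theorem exists_transGen_of_A_b (V : St) :
    ∃ k, Relation.TransGen (fun V V' => 0 < Qmat qv V V') (.inl (.b, k)) V := by
  obtain ⟨e, k⟩ | ⟨e, ⟨k, l⟩, hkl⟩ := V
  · cases e
    · exact ⟨k, transGen_A_b h0 k k⟩
    · obtain ⟨l, hkl⟩ := exists_ne k
      obtain ⟨m, hkm, hlm⟩ := exists_third hkl.symm
      refine ⟨l, .tail (b := .inr (.b, ⟨(l, m), hlm⟩)) (.single ?_) ?_⟩
      · simp [Qmat, h0]
      · simp [Qmat, third_eq hlm hkl hkm.symm, h1]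
  · refine ⟨k, .single ?_⟩
    cases e
    · simp [Qmat, h0]
    · simp [Qmat, h1]

theorem Qmat_pow_pos (V V' : St) : ∃ t : ℕ, 1 ≤ t ∧ 0 < (Qmat qv ^ t) V V' := by
  obtain ⟨k, hk⟩ := exists_Qmat_A_b_pos h0 V
  obtain ⟨l, hl⟩ := exists_transGen_of_A_b h0 h1 V'
  exact Matrix.exists_pow_pos_of_transGen
    (fun _ _ => Matrix.nonneg_of_mem_rowStochastic
      (Qmat_mem_rowStochastic (fun k => (h0 k).le) h1.le))
    (.trans (.head hk (transGen_A_b h0 k l)) hl)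

end Chain

theorem abs_mul_le_mul {c t c₀ K : ℝ} (hc : |c| ≤ c₀) (ht : |t| ≤ K) : |c * t| ≤ c₀ * K := by
  rw [abs_mul]
  exact mul_le_mul hc ht (abs_nonneg t) ((abs_nonneg c).trans hc)

theorem abs_le_of_abs_mul_le {c t c₀ K : ℝ} (hc₀ : 0 < c₀) (hc : c₀ ≤ c)
    (h : |c * t| ≤ c₀ * K) : |t| ≤ K := by
  rw [abs_mul, abs_of_pos (hc₀.trans_le hc)] at h
  exact le_of_mul_le_mul_left ((mul_le_mul_of_nonneg_right hc (abs_nonneg t)).trans h) hc₀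

/-- 13 / 2 * ε zero-sum solution of the balanced stationarity equations of the chain lumped over the edge
type is controlled by the residuals, uniformly in `q`. -/
theorem lumped_bound {q ε x y z bxy bxz byx byz bzx bzy r sxy sxz syx syz szx szy : ℝ}
    (hq0 : 0 < q) (hq1 : q < 1) (hsum : x + y + z + bxy + bxz + byx + byz + bzx + bzy = 0)
    (hx : x = q / 3 * (y + z + bxy + bxz) + (1 - q) * (byz + bzy) + r)
    (hxy : bxy = (1 - 2 * q / 3) / 2 * x + q / 3 * (bxz + bzx) + sxy)
    (hxz : bxz = (1 - 2 * q / 3) / 2 * x + q / 3 * (bxy + byx) + sxz)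
    (hyx : byx = (1 - 2 * q / 3) / 2 * y + q / 3 * (byz + bzy) + syx)
    (hyz : byz = (1 - 2 * q / 3) / 2 * y + q / 3 * (byx + bxy) + syz)
    (hzx : bzx = (1 - 2 * q / 3) / 2 * z + q / 3 * (bzy + byz) + szx)
    (hzy : bzy = (1 - 2 * q / 3) / 2 * z + q / 3 * (bzx + bxz) + szy)
    (hr : |r| ≤ ε) (hsxy : |sxy| ≤ ε) (hsxz : |sxz| ≤ ε) (hsyx : |syx| ≤ ε) (hsyz : |syz| ≤ ε)
    (hszx : |szx| ≤ ε) (hszy : |szy| ≤ ε) : |x| ≤ 14 * ε ∧ |byz + bzy| ≤ 14 * ε := by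
  have hε : 0 ≤ ε := (abs_nonneg r).trans hr
  have hqq : q ^ 2 ≤ q := by nlinarith
  have hqq0 : 0 ≤ q ^ 2 := sq_nonneg q
  obtain ⟨hsxy, hsxy'⟩ := abs_le.1 hsxy
  obtain ⟨hsxz, hsxz'⟩ := abs_le.1 hsxz
  obtain ⟨hsyx, hsyx'⟩ := abs_le.1 hsyx
  obtain ⟨hsyz, hsyz'⟩ := abs_le.1 hsyz
  obtain ⟨hszx, hszx'⟩ := abs_le.1 hszx
  obtain ⟨hszy, hszy'⟩ := abs_le.1 hszy
  obtain ⟨hr, hr'⟩ := abs_le.1 hr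
  obtain ⟨u, hu⟩ : ∃ u, u = byz + bzy := ⟨_, rfl⟩
  obtain ⟨T, hT⟩ : ∃ T, T = bxy + bxz + byx + byz + bzx + bzy := ⟨_, rfl⟩
  have hTbound : |T| ≤ 9 * ε := by
    refine abs_le_of_abs_mul_le (c := 2 * (1 - 2 * q / 3)) (c₀ := 2 / 3) (by norm_num)
      (by linarith) ?_
    rw [show 2 * (1 - 2 * q / 3) * T = sxy + sxz + syx + syz + szx + szy by
      linear_combination hxy + hxz + hyx + hyz + hzx + hzy + (1 - 2 * q / 3) * hsum
        + (2 - 4 * q / 3) * hT]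
    rw [abs_le]
    constructor <;> linarith
  obtain ⟨E, hEdef⟩ : ∃ E, E = (2 * q / 3 - 1 / 2) * T + (syz + szy) := ⟨_, rfl⟩
  have hE : |E| ≤ 13 / 2 * ε := by
    rw [hEdef]
    have h := abs_mul_le_mul (c := 2 * q / 3 - 1 / 2) (c₀ := 1 / 2)
      (by rw [abs_le]; constructor <;> linarith) hTbound
    rw [abs_le] at h ⊢
    constructor <;> linarith
  obtain ⟨F, hFdef⟩ : ∃ F, F = (q ^ 2 / 9 - q / 3) * T + q / 3 * (sxy + sxz) + r := ⟨_, rfl⟩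
  have hF : |F| ≤ 5 * ε := by
    rw [hFdef]
    have h := abs_mul_le_mul (c := q ^ 2 / 9 - q / 3) (c₀ := 1 / 3)
      (by rw [abs_le]; constructor <;> linarith) hTbound
    have h' := abs_mul_le_mul (t := sxy + sxz) (c := q / 3) (c₀ := 1 / 3) (K := 2 * ε)
      (by rw [abs_le]; constructor <;> linarith) (by rw [abs_le]; constructor <;> linarith)
    rw [abs_le] at h h' ⊢
    constructor <;> linarith
  have hux : (1 + q / 3) * u = -((1 - 2 * q / 3) / 2) * x + E := by
    linear_combination hyz + hzy + (1 + q / 3) * hu + (1 - 2 * q / 3) / 2 * hsum - hEdef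
      - (2 * q / 3 - 1 / 2) * hT
  have hxu : (1 + 2 * q ^ 2 / 9) * x = (1 - q - q ^ 2 / 9) * u + F := by
    linear_combination hx + q / 3 * (hxy + hxz) + q / 3 * hsum - (1 - q - q ^ 2 / 9) * hu - hFdef
      - (q ^ 2 / 9 - q / 3) * hT
  have hxbound : |x| ≤ 14 * ε := by
    have hq3 : 0 ≤ q ^ 3 := pow_nonneg hq0.le 3
    refine abs_le_of_abs_mul_le (c := 3 / 2 - q / 2 + q ^ 2 / 2 + q ^ 3 / 9) zero_lt_one
      (by linarith) ?_
    rw [show (3 / 2 - q / 2 + q ^ 2 / 2 + q ^ 3 / 9) * x =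
      (1 - q - q ^ 2 / 9) * E + (1 + q / 3) * F by
      linear_combination (1 - q - q ^ 2 / 9) * hux + (1 + q / 3) * hxu]
    have h := abs_mul_le_mul (c := 1 - q - q ^ 2 / 9) (c₀ := 1)
      (by rw [abs_le]; constructor <;> linarith) hE
    have h' := abs_mul_le_mul (c := 1 + q / 3) (c₀ := 4 / 3)
      (by rw [abs_le]; constructor <;> linarith) hF
    rw [abs_le] at h h' ⊢
    constructor <;> linarith
  refine ⟨hxbound, abs_le_of_abs_mul_le (c := 1 + q / 3) zero_lt_one (by linarith) ?_⟩
  have h := abs_mul_le_mul (c := -((1 - 2 * q / 3) / 2)) (c₀ := 1 / 2)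
      (by rw [abs_le]; constructor <;> linarith) hxbound
  rw [← hu, hux]
  rw [abs_le] at h hE ⊢
  constructor <;> linarith

theorem abs_add_mul_le {v w s t ε : ℝ} (hv : 0 ≤ v) (hw : 0 ≤ w) (hvw : v + w ≤ 1) (hs : |s| ≤ ε)
    (ht : |t| ≤ ε) : |v * s + w * t| ≤ ε := by
  have hε : 0 ≤ ε := (abs_nonneg s).trans hs
  have h1 := abs_mul_le_mul (abs_of_nonneg hv).le hs
  have h2 := abs_mul_le_mul (abs_of_nonneg hw).le ht
  calc |v * s + w * t| ≤ |v * s| + |w * t| := abs_add_le _ _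
    _ ≤ (v + w) * ε := by linarith
    _ ≤ ε := mul_le_of_le_one_left hε hvw

section Deviation

variable {q ε : ℝ} {qv : Fin 3 → ℝ} {p : St → ℝ} (hsum : qv 0 + qv 1 + qv 2 = q)
  (hd : ∀ k, |qv k - q / 3| ≤ ε) (hq0 : 0 < q) (hq1 : q < 1) (hp0 : ∀ V, 0 ≤ p V)
  (hp1 : ∑ V, p V = 1) (hp : ∀ V', ∑ V, p V * Qmat qv V V' = p V')
  {k l m : Fin 3} (hkl : k ≠ l) (hkm : k ≠ m) (hlm : l ≠ m)

include hp0 in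
theorem margA_nonneg (k : Fin 3) : 0 ≤ margA p k := add_nonneg (hp0 _) (hp0 _)

include hp0 in
theorem margB_nonneg {k l : Fin 3} (h : k ≠ l) : 0 ≤ margB p h := add_nonneg (hp0 _) (hp0 _)

include hkl hkm hlm

include hp1 in
theorem sum_marg_eq_one : margA p k + margA p l + margA p m + margB p hkl + margB p hkm +
    margB p hkl.symm + margB p hlm + margB p hkm.symm + margB p hlm.symm = 1 :=
  (sum_St hkl hkm hlm p).symm.trans hp1

include hp0 hp1 hd

theorem abs_residual_A_le :
    |(margA p l + margB p hkl) * (qv m - q / 3) + (margA p m + margB p hkm) * (qv l - q / 3)|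
      ≤ ε := by
  have h1 := sum_marg_eq_one hp1 hkl hkm hlm
  have hA := margA_nonneg hp0
  have hB {k l : Fin 3} (h : k ≠ l) := margB_nonneg hp0 h
  refine abs_add_mul_le (add_nonneg (hA _) (hB _)) (add_nonneg (hA _) (hB _)) ?_ (hd m) (hd l)
  linarith [hA k, hB hkl.symm, hB hkm.symm, hB hlm, hB hlm.symm]

theorem abs_residual_B_le :
    |(margA p k / 2 + (margB p hkm + margB p hkm.symm)) * (qv k - q / 3)| ≤ ε := by
  have h1 := sum_marg_eq_one hp1 hkl hkm hlm
  have hA := margA_nonneg hp0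
  have hB {k l : Fin 3} (h : k ≠ l) := margB_nonneg hp0 h
  rw [add_mul]
  refine abs_add_mul_le (div_nonneg (hA _) two_pos.le) (add_nonneg (hB _) (hB _)) ?_ (hd k) (hd k)
  linarith [hA k, hA l, hA m, hB hkl, hB hkl.symm, hB hlm, hB hlm.symm]

omit hd hp0 hp1
include hp hsum

theorem margA_sub_eq : margA p k - 1 / 6 =
    q / 3 * ((margA p l - 1 / 6) + (margA p m - 1 / 6) + (margB p hkl - 1 / 12) +
      (margB p hkm - 1 / 12)) +
    (1 - q) * ((margB p hlm - 1 / 12) + (margB p hlm.symm - 1 / 12)) +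
    ((margA p l + margB p hkl) * (qv m - q / 3) + (margA p m + margB p hkm) * (qv l - q / 3)) := by
  have hb := sum_mul_Qmat_A_b hkl hkm hlm p qv
  have hf := sum_mul_Qmat_A_f hkl hkm hlm p qv
  rw [hp] at hb hf
  rw [hsum] at hf
  have h : margA p k = p (.inl (.b, k)) + p (.inl (.f, k)) := rfl
  linear_combination h + hb + hf

theorem margB_sub_eq : margB p hkl - 1 / 12 =
    (1 - 2 * q / 3) / 2 * (margA p k - 1 / 6) +
    q / 3 * ((margB p hkm - 1 / 12) + (margB p hkm.symm - 1 / 12)) +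
    (margA p k / 2 + (margB p hkm + margB p hkm.symm)) * (qv k - q / 3) := by
  have hb := sum_mul_Qmat_B_b hkl hkm hlm p qv
  have hf := sum_mul_Qmat_B_f hkl hkm hlm p qv
  rw [hp] at hb hf
  rw [hsum] at hf
  have h : margB p hkl = p (.inr (.b, ⟨(k, l), hkl⟩)) + p (.inr (.f, ⟨(k, l), hkl⟩)) := rfl
  linear_combination h + hb + hf

include hd hq0 hq1 hp0 hp1

theorem abs_marg_sub_le : |margA p k - 1 / 6| ≤ 14 * ε ∧
    |(margB p hlm - 1 / 12) + (margB p hlm.symm - 1 / 12)| ≤ 14 * ε := by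
  have h1 := sum_marg_eq_one hp1 hkl hkm hlm
  exact lumped_bound hq0 hq1 (by linear_combination h1)
    (margA_sub_eq hsum hp hkl hkm hlm)
    (margB_sub_eq hsum hp hkl hkm hlm)
    (margB_sub_eq hsum hp hkm hkl hlm.symm)
    (margB_sub_eq hsum hp hkl.symm hlm hkm)
    (margB_sub_eq hsum hp hlm hkl.symm hkm.symm)
    (margB_sub_eq hsum hp hkm.symm hlm.symm hkl)
    (margB_sub_eq hsum hp hlm.symm hkm.symm hkl.symm)
    (abs_residual_A_le hd hp0 hp1 hkl hkm hlm)
    (abs_residual_B_le hd hp0 hp1 hkl hkm hlm)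
    (abs_residual_B_le hd hp0 hp1 hkm hkl hlm.symm)
    (abs_residual_B_le hd hp0 hp1 hkl.symm hlm hkm)
    (abs_residual_B_le hd hp0 hp1 hlm hkl.symm hkm.symm)
    (abs_residual_B_le hd hp0 hp1 hkm.symm hlm.symm hkl)
    (abs_residual_B_le hd hp0 hp1 hlm.symm hkm.symm hkl.symm)

theorem abs_margB_sub_le : |margB p hkl - 1 / 12| ≤ 14 * ε := by
  have hA := (abs_marg_sub_le hsum hd hq0 hq1 hp0 hp1 hp hkl hkm hlm).1
  have hB := (abs_marg_sub_le hsum hd hq0 hq1 hp0 hp1 hp hkl.symm hlm hkm).2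
  have hs := abs_residual_B_le hd hp0 hp1 hkl hkm hlm
  have hε : 0 ≤ ε := (abs_nonneg _).trans hs
  have h1 := abs_mul_le_mul (c := (1 - 2 * q / 3) / 2) (c₀ := 1 / 2)
    (by rw [abs_le]; constructor <;> linarith) hA
  have h2 := abs_mul_le_mul (c := q / 3) (c₀ := 1 / 3)
    (by rw [abs_le]; constructor <;> linarith) hB
  rw [margB_sub_eq hsum hp hkl hkm hlm]
  rw [abs_le] at h1 h2 hs ⊢
  constructor <;> linarith

theorem abs_A_b_sub_le : |p (.inl (.b, k)) - q / 6| ≤ 20 * ε := by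
  have hl := (abs_marg_sub_le hsum hd hq0 hq1 hp0 hp1 hp hkl.symm hlm hkm).1
  have hm := (abs_marg_sub_le hsum hd hq0 hq1 hp0 hp1 hp hkm.symm hlm.symm hkl).1
  have hBl := abs_margB_sub_le hsum hd hq0 hq1 hp0 hp1 hp hkl hkm hlm
  have hBm := abs_margB_sub_le hsum hd hq0 hq1 hp0 hp1 hp hkm hkl hlm.symm
  have hr := abs_residual_A_le hd hp0 hp1 hkl hkm hlm
  have hε : 0 ≤ ε := (abs_nonneg _).trans hr
  have h := abs_mul_le_mul (c := q / 3) (c₀ := 1 / 3) (K := 56 * ε)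
    (t := (margA p l - 1 / 6) + (margA p m - 1 / 6) + (margB p hkl - 1 / 12) +
      (margB p hkm - 1 / 12))
    (by rw [abs_le]; constructor <;> linarith)
    (by rw [abs_le] at *; constructor <;> linarith)
  rw [← hp, sum_mul_Qmat_A_b hkl hkm hlm]
  rw [abs_le] at h hr ⊢
  constructor <;> linarith

theorem abs_A_f_sub_le : |p (.inl (.f, k)) - (1 - q) / 6| ≤ 20 * ε := by
  have hB := (abs_marg_sub_le hsum hd hq0 hq1 hp0 hp1 hp hkl hkm hlm).2
  have hε : 0 ≤ ε := (abs_nonneg _).trans (hd k)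
  have h := abs_mul_le_mul (c := 1 - q) (c₀ := 1)
    (by rw [abs_le]; constructor <;> linarith) hB
  rw [← hp, sum_mul_Qmat_A_f hkl hkm hlm, hsum]
  rw [abs_le] at h ⊢
  constructor <;> linarith

theorem abs_B_b_sub_le : |p (.inr (.b, ⟨(k, l), hkl⟩)) - q / 12| ≤ 20 * ε := by
  have hA := (abs_marg_sub_le hsum hd hq0 hq1 hp0 hp1 hp hkl hkm hlm).1
  have hB := (abs_marg_sub_le hsum hd hq0 hq1 hp0 hp1 hp hkl.symm hlm hkm).2
  have hs := abs_residual_B_le hd hp0 hp1 hkl hkm hlm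
  have hε : 0 ≤ ε := (abs_nonneg _).trans hs
  have h1 := abs_mul_le_mul (c := q / 6) (c₀ := 1 / 6)
    (by rw [abs_le]; constructor <;> linarith) hA
  have h2 := abs_mul_le_mul (c := q / 3) (c₀ := 1 / 3)
    (by rw [abs_le]; constructor <;> linarith) hB
  rw [← hp, sum_mul_Qmat_B_b hkl hkm hlm]
  rw [abs_le] at h1 h2 hs ⊢
  constructor <;> linarith

theorem abs_B_f_sub_le : |p (.inr (.f, ⟨(k, l), hkl⟩)) - (1 - q) / 12| ≤ 20 * ε := by
  have hA := (abs_marg_sub_le hsum hd hq0 hq1 hp0 hp1 hp hkl hkm hlm).1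
  have hε : 0 ≤ ε := (abs_nonneg _).trans (hd k)
  have h := abs_mul_le_mul (c := (1 - q) / 2) (c₀ := 1 / 2)
    (by rw [abs_le]; constructor <;> linarith) hA
  rw [← hp, sum_mul_Qmat_B_f hkl hkm hlm, hsum]
  rw [abs_le] at h ⊢
  constructor <;> linarith

omit hkl hkm hlm

theorem abs_sub_piBal_le (V : St) : |p V - piBal q V| ≤ 20 * ε := by
  obtain ⟨e, k⟩ | ⟨e, ⟨k, l⟩, hkl⟩ := V
  · obtain ⟨l, hlk⟩ := exists_ne k
    obtain ⟨m, hkm, hlm⟩ := exists_third hlk.symm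
    cases e
    · exact abs_A_b_sub_le hsum hd hq0 hq1 hp0 hp1 hp hlk.symm hkm hlm
    · exact abs_A_f_sub_le hsum hd hq0 hq1 hp0 hp1 hp hlk.symm hkm hlm
  · obtain ⟨m, hkm, hlm⟩ := exists_third hkl
    cases e
    · exact abs_B_b_sub_le hsum hd hq0 hq1 hp0 hp1 hp hkl hkm hlm
    · exact abs_B_f_sub_le hsum hd hq0 hq1 hp0 hp1 hp hkl hkm hlm

end Deviation

/-- There is a constant `C > 1` such that whenever `q ∈ (0,1)`, `γ ∈ (0,1)` and
`q₁+q₂+q₃ = q` with `(1−γ)q/3 < q_k < (1+γ)q/3` for each `k`, the matrix `Q` is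
irreducible, has a unique stationary distribution `π`, and this stationary
distribution satisfies `‖π − π_bal‖_∞ ≤ 3Cγq`. -/
theorem stmt12 :
    ∃ C : ℝ, 1 < C ∧
      ∀ (q γ : ℝ) (qv : Fin 3 → ℝ), 0 < q → q < 1 → 0 < γ → γ < 1 →
        (∀ k, 0 < qv k) → qv 0 + qv 1 + qv 2 = q →
        (∀ k, (1 - γ) * (q / 3) < qv k ∧ qv k < (1 + γ) * (q / 3)) →
        (∀ V V' : St, ∃ t : ℕ, 1 ≤ t ∧ 0 < (Qmat qv ^ t) V V') ∧
        (∃! π : St → ℝ, (∀ V, 0 ≤ π V) ∧ (∑ V : St, π V) = 1 ∧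
            ∀ V' : St, (∑ V : St, π V * Qmat qv V V') = π V') ∧
        ∀ π : St → ℝ,
          ((∀ V, 0 ≤ π V) ∧ (∑ V : St, π V) = 1 ∧
            ∀ V' : St, (∑ V : St, π V * Qmat qv V V') = π V') →
          ∀ V : St, |π V - piBal q V| ≤ 3 * C * γ * q := by
  refine ⟨3, by norm_num, fun q γ qv hq0 hq1 hγ0 hγ1 h0 hsum hγ => ?_⟩
  have h1 : qv 0 + qv 1 + qv 2 < 1 := hsum.trans_lt hq1
  have hirr := Qmat_pow_pos h0 h1
  have : Nonempty St := ⟨.inl (.b, 0)⟩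
  refine ⟨hirr, Matrix.existsUnique_stationary
    (Qmat_mem_rowStochastic (fun k => (h0 k).le) h1.le) hirr, ?_⟩
  rintro p ⟨hp0, hp1, hp⟩ V
  have hd (k : Fin 3) : |qv k - q / 3| ≤ γ * q / 3 := by
    obtain ⟨h, h'⟩ := hγ k
    rw [abs_le]
    constructor <;> linarith
  have hγq := mul_pos hγ0 hq0
  linarith [abs_sub_piBal_le hsum hd hq0 hq1 hp0 hp1 hp V]
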